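/- Let k be a field of characteristic zero, V a vector superspace over k, and x an odd nilpotent endomorphism of V such that the pair (V, x) is neat. Then there exist an even endomorphism h of V and an odd endomorphism Y of V satisfying h∘x − x∘h = −2x, h∘Y − Y∘h = 2Y, and Y∘x + x∘Y = h (these are the defining relations of the Lie superalgebra osp(1|2) on its standard generators; thus x extends to a representation of osp(1|2) on V). [Super Jacobson–Morozov lemma, instance G = GL(V).] -/

import Mathlib

open scoped TensorProduct

section Defs

variable (k : Type*) [Field k]

def IsEvenMap {V : Type*} [AddCommGroup V] [Module k V]
    (V0 V1 : Submodule k V) (f : V →ₗ[k] V) : Prop :=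
  (∀ v ∈ V0, f v ∈ V0) ∧ (∀ v ∈ V1, f v ∈ V1)

def IsOddMap {V : Type*} [AddCommGroup V] [Module k V]
    (V0 V1 : Submodule k V) (f : V →ₗ[k] V) : Prop :=
  (∀ v ∈ V0, f v ∈ V1) ∧ (∀ v ∈ V1, f v ∈ V0)

/-- The shift endomorphism of the string module `M_n`: sends basis vector `a_j` to `a_{j+1}`,
and `a_n` to `0`.  In coordinates, `(x f) j = f (j-1)` for `j ≥ 1` and `(x f) 0 = 0`. -/
def shiftMap (n : ℕ) : (Fin (n+1) → k) →ₗ[k] (Fin (n+1) → k) where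
  toFun f := fun j =>
    if (j : ℕ) = 0 then 0 else f ⟨(j : ℕ) - 1, Nat.lt_of_le_of_lt (Nat.sub_le _ _) j.isLt⟩
  map_add' f g := by funext j; simp only [Pi.add_apply]; split_ifs <;> simp
  map_smul' c f := by funext j; simp only [Pi.smul_apply]; split_ifs <;> simp

/-- The even (`r = 0`) resp. odd (`r = 1`) part of the string module `Π^ε M_n`:
coordinates `j` with `(j + ε) % 2 = r`. -/
def stringPart (n ε r : ℕ) : Submodule k (Fin (n+1) → k) :=
  Submodule.pi Set.univ (fun j => if ((j : ℕ) + ε) % 2 = r then (⊤ : Submodule k k) else ⊥)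

/-- Isomorphism of pairs (vector superspace with endomorphism): an even linear isomorphism
intertwining the endomorphisms. -/
def PairIso {V : Type*} [AddCommGroup V] [Module k V]
    (V0 V1 : Submodule k V) (x : V →ₗ[k] V)
    {W : Type*} [AddCommGroup W] [Module k W]
    (W0 W1 : Submodule k W) (y : W →ₗ[k] W) : Prop :=
  ∃ φ : V ≃ₗ[k] W, (∀ v ∈ V0, φ v ∈ W0) ∧ (∀ v ∈ V1, φ v ∈ W1) ∧ ∀ v, φ (x v) = y (φ v)

/-- `V` decomposes as a direct sum of `x`-invariant graded subspaces, each isomorphic as a pair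
to some `Π^ε M_n` with `P n`. -/
def DecomposesIntoStrings {V : Type*} [AddCommGroup V] [Module k V]
    (V0 V1 : Submodule k V) (x : V →ₗ[k] V) (P : ℕ → Prop) : Prop :=
  ∃ (m : ℕ) (U : Fin m → Submodule k V), DirectSum.IsInternal U ∧
    ∀ i : Fin m, (U i = (U i ⊓ V0) ⊔ (U i ⊓ V1)) ∧
      ∃ (hx : ∀ v ∈ U i, x v ∈ U i) (n ε : ℕ), ε ≤ 1 ∧ P n ∧
        PairIso k (V0.comap (U i).subtype) (V1.comap (U i).subtype) (x.restrict hx)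
          (stringPart k n ε 0) (stringPart k n ε 1) (shiftMap k n)

/-- A pair `(V, x)` (odd nilpotent `x`) is neat if it decomposes into strings `Π^ε M_{2s}`. -/
def IsNeat {V : Type*} [AddCommGroup V] [Module k V]
    (V0 V1 : Submodule k V) (x : V →ₗ[k] V) : Prop :=
  DecomposesIntoStrings k V0 V1 x (fun n => Even n)

end Defs


/-- A linear map is determined in parity by its values on a homogeneous basis. -/
lemma sjm_parity {k V ι : Type*} [Field k] [AddCommGroup V] [Module k V] [Fintype ι]
    (A B T : Submodule k V) (hd : Disjoint A B) (b : Module.Basis ι k V)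
    (hb : ∀ i, b i ∈ A ∨ b i ∈ B) (f : V →ₗ[k] V) (hf : ∀ i, b i ∈ A → f (b i) ∈ T)
    (v : V) (hv : v ∈ A) : f v ∈ T := by
  classical
  have e := b.sum_repr v
  rw [← Finset.sum_filter_add_sum_filter_not Finset.univ (fun i => b i ∈ A)] at e
  have hP : ∑ i with b i ∈ A, b.repr v i • b i ∈ A :=
    Submodule.sum_mem _ fun i hi => A.smul_mem _ (Finset.mem_filter.1 hi).2
  have hQ : ∑ i with b i ∉ A, b.repr v i • b i ∈ B :=
    Submodule.sum_mem _ fun i hi => B.smul_mem _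
      ((hb i).resolve_left (Finset.mem_filter.1 hi).2)
  have hQ' : ∑ i with b i ∉ A, b.repr v i • b i ∈ A := by
    rw [← eq_sub_iff_add_eq'] at e
    rw [e]; exact A.sub_mem hv hP
  rw [Submodule.disjoint_def.1 hd _ hQ' hQ, add_zero] at e
  rw [← e, map_sum]
  refine Submodule.sum_mem _ fun i hi => ?_
  rw [map_smul]
  exact T.smul_mem _ (hf i (Finset.mem_filter.1 hi).2)

lemma sjm_mem_stringPart {k : Type*} [Field k] (n ε r : ℕ) (f : Fin (n+1) → k) :
    f ∈ stringPart k n ε r ↔ ∀ j : Fin (n+1), ((j : ℕ) + ε) % 2 ≠ r → f j = 0 := by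
  simp only [stringPart, Submodule.mem_pi, Set.mem_univ, true_imp_iff]
  refine forall_congr' fun j => ?_
  by_cases h : ((j : ℕ) + ε) % 2 = r <;> simp [h]

lemma sjm_shift {k : Type*} [Field k] (n : ℕ) (j : Fin (n+1)) :
    shiftMap k n (Pi.single j 1) =
      if h : (j : ℕ) + 1 < n + 1 then Pi.single ⟨j + 1, h⟩ 1 else 0 := by
  funext l
  have hl := l.isLt
  have hj := j.isLt
  simp only [shiftMap, LinearMap.coe_mk, AddHom.coe_mk, Pi.single_apply, Fin.ext_iff]
  by_cases h : (j : ℕ) + 1 < n + 1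
  · rw [dif_pos h, Pi.single_apply]
    simp only [Fin.ext_iff]
    split_ifs <;> first | rfl | omega
  · rw [dif_neg h, Pi.zero_apply]
    split_ifs <;> first | rfl | omega

/-- Basis of a string. -/
lemma sjm_string {k V : Type*} [Field k] [AddCommGroup V] [Module k V]
    (V0 V1 : Submodule k V) (x : V →ₗ[k] V) (U : Submodule k V)
    (hU : U = (U ⊓ V0) ⊔ (U ⊓ V1)) (hx : ∀ v ∈ U, x v ∈ U) (n ε : ℕ)
    (h : PairIso k (V0.comap U.subtype) (V1.comap U.subtype) (x.restrict hx)
          (stringPart k n ε 0) (stringPart k n ε 1) (shiftMap k n)) :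
    ∃ b : Module.Basis (Fin (n+1)) k U,
      (∀ j : Fin (n+1), ((j : ℕ) + ε) % 2 = 0 → (b j : V) ∈ V0) ∧
      (∀ j : Fin (n+1), ((j : ℕ) + ε) % 2 = 1 → (b j : V) ∈ V1) ∧
      (∀ j : Fin (n+1), x (b j : V) =
        if h : (j : ℕ) + 1 < n + 1 then (b ⟨j + 1, h⟩ : V) else 0) := by
  obtain ⟨φ, h0, h1, hφ⟩ := h
  have hb : ∀ j, (Module.Basis.ofEquivFun φ) j = φ.symm (Pi.single j 1) := fun j => by
    simp
  have key : ∀ j : Fin (n+1), ∃ w0 w1 : U, (w0 : V) ∈ V0 ∧ (w1 : V) ∈ V1 ∧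
      φ.symm (Pi.single j 1) = w0 + w1 ∧ φ w0 + φ w1 = Pi.single j 1 ∧
      φ w0 ∈ stringPart k n ε 0 ∧ φ w1 ∈ stringPart k n ε 1 := by
    intro j
    have hm : ((φ.symm (Pi.single j 1) : U) : V) ∈ (U ⊓ V0) ⊔ (U ⊓ V1) := by
      rw [← hU]; exact (φ.symm (Pi.single j 1)).2
    obtain ⟨a, ha, c, hc, hac⟩ := Submodule.mem_sup.1 hm
    have e : φ.symm (Pi.single j 1) = (⟨a, ha.1⟩ : U) + ⟨c, hc.1⟩ := by
      ext; simp [hac]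
    refine ⟨⟨a, ha.1⟩, ⟨c, hc.1⟩, ha.2, hc.2, e, ?_, h0 _ ha.2, h1 _ hc.2⟩
    rw [← map_add, ← e, LinearEquiv.apply_symm_apply]
  refine ⟨Module.Basis.ofEquivFun φ, fun j hj => ?_, fun j hj => ?_, fun j => ?_⟩
  · rw [hb]
    obtain ⟨w0, w1, m0, m1, e, e', s0, s1⟩ := key j
    have : φ w1 = 0 := by
      funext l
      rw [sjm_mem_stringPart] at s0 s1
      by_cases hl : ((l : ℕ) + ε) % 2 = 1
      · have := congrFun e' l
        rw [Pi.add_apply, s0 l (by omega), Pi.single_apply, if_neg (by rintro rfl; omega)] at this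
        simpa using this
      · exact s1 l hl
    rw [LinearEquiv.map_eq_zero_iff] at this
    rw [e, this, add_zero]; exact m0
  · rw [hb]
    obtain ⟨w0, w1, m0, m1, e, e', s0, s1⟩ := key j
    have : φ w0 = 0 := by
      funext l
      rw [sjm_mem_stringPart] at s0 s1
      by_cases hl : ((l : ℕ) + ε) % 2 = 0
      · have := congrFun e' l
        rw [Pi.add_apply, s1 l (by omega), Pi.single_apply, if_neg (by rintro rfl; omega)] at this
        simpa using this
      · exact s0 l hl
    rw [LinearEquiv.map_eq_zero_iff] at this
    rw [e, this, zero_add]; exact m1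
  · have e := hφ (φ.symm (Pi.single j 1))
    rw [LinearEquiv.apply_symm_apply, sjm_shift, ← LinearEquiv.eq_symm_apply] at e
    have e2 := congrArg (Subtype.val) e
    rw [LinearMap.coe_restrict_apply] at e2
    rw [hb, e2]
    split_ifs
    · rw [hb]
    · simp

/-- Coefficients of the lowering operator. -/
def sjmCoef (k : Type*) [Field k] (n j : ℕ) : k :=
  if j % 2 = 0 then -(j : k) else (n : k) + 1 - j

lemma sjmCoef_add (k : Type*) [Field k] (n j : ℕ) :
    sjmCoef k n (j+1) + sjmCoef k n j = (n : k) - 2 * j := by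
  unfold sjmCoef
  rcases Nat.mod_two_eq_zero_or_one j with h | h
  · rw [if_neg (by omega), if_pos h]; push_cast; ring
  · rw [if_pos (by omega), if_neg (by omega)]; push_cast; ring

lemma sjmCoef_last (k : Type*) [Field k] (n : ℕ) (hn : Even n) : sjmCoef k n (n+1) = 0 := by
  have := Nat.even_iff.1 hn
  unfold sjmCoef
  rw [if_neg (by omega)]; push_cast; ring

/-- **Super Jacobson–Morozov lemma** (instance `G = GL(V)`): if `x` is an odd nilpotent
endomorphism of a vector superspace `V` over a field of characteristic zero and `(V, x)` is
neat, then `x` extends to a representation of `osp(1|2)` on `V`: there are an even `h` and an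
odd `Y` with `h∘x − x∘h = −2x`, `h∘Y − Y∘h = 2Y`, `Y∘x + x∘Y = h`. -/
theorem super_jacobson_morozov {k : Type*} [Field k] [CharZero k]
    (V : Type*) [AddCommGroup V] [Module k V] [FiniteDimensional k V]
    (V0 V1 : Submodule k V) (hcompl : IsCompl V0 V1)
    (x : V →ₗ[k] V) (hodd : IsOddMap k V0 V1 x) (hnil : IsNilpotent x)
    (hneat : IsNeat k V0 V1 x) :
    ∃ (h Y : V →ₗ[k] V), IsEvenMap k V0 V1 h ∧ IsOddMap k V0 V1 Y ∧
      h ∘ₗ x - x ∘ₗ h = -((2 : k) • x) ∧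
      h ∘ₗ Y - Y ∘ₗ h = (2 : k) • Y ∧
      Y ∘ₗ x + x ∘ₗ Y = h := by
  obtain ⟨m, U, hU, hs⟩ := hneat
  choose hg hx n ε hε hev hiso using hs
  choose c c0 c1 cx using fun i => sjm_string V0 V1 x (U i) (hg i) (hx i) (n i) (ε i) (hiso i)
  let b := hU.collectedBasis c
  have hbc : ∀ i j, b ⟨i, j⟩ = (c i j : V) := fun i j => by
    simp [b, DirectSum.IsInternal.collectedBasis_coe]
  -- extension of the basis by zero
  let a : Fin m → ℕ → V := fun i j => if hj : j < n i + 1 then b ⟨i, ⟨j, hj⟩⟩ else 0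
  have ab : ∀ i (j : Fin (n i + 1)), b ⟨i, j⟩ = a i j := fun i j => by
    simp only [a]; rw [dif_pos j.isLt]
  have ax : ∀ i j, x (a i j) = a i (j+1) := by
    intro i j
    by_cases hj : j < n i + 1
    · rw [show a i j = b ⟨i, ⟨j, hj⟩⟩ from (ab i ⟨j, hj⟩).symm, hbc, cx]
      by_cases h2 : j + 1 < n i + 1
      · simp only [a, dif_pos h2, hbc]
      · simp only [a, dif_neg h2]
    · have h2 : ¬ (j + 1 < n i + 1) := by omega
      simp only [a, dif_neg hj, dif_neg h2, map_zero]
  have az : ∀ i j, n i + 1 ≤ j → a i j = 0 := fun i j h => by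
    simp only [a]; rw [dif_neg (by omega)]
  have a0 : ∀ i j, (j + ε i) % 2 = 0 → a i j ∈ V0 := by
    intro i j h
    by_cases hj : j < n i + 1
    · simp only [a, dif_pos hj, hbc]; exact c0 i _ h
    · rw [az i j (by omega)]; exact V0.zero_mem
  have a1 : ∀ i j, (j + ε i) % 2 = 1 → a i j ∈ V1 := by
    intro i j h
    by_cases hj : j < n i + 1
    · simp only [a, dif_pos hj, hbc]; exact c1 i _ h
    · rw [az i j (by omega)]; exact V1.zero_mem
  let Y : V →ₗ[k] V := b.constr k fun p => sjmCoef k (n p.1) p.2 • a p.1 (p.2 - 1)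
  let h : V →ₗ[k] V := b.constr k fun p => ((n p.1 : k) - 2 * ((p.2 : ℕ) : k)) • a p.1 p.2
  have aY : ∀ i j, Y (a i j) = sjmCoef k (n i) j • a i (j - 1) := by
    intro i j
    by_cases hj : j < n i + 1
    · rw [show a i j = b ⟨i, ⟨j, hj⟩⟩ from (ab i ⟨j, hj⟩).symm]
      exact b.constr_basis k _ _
    · rw [az i j (by omega), map_zero]
      rcases Nat.eq_or_lt_of_le (Nat.le_of_not_lt hj) with h | h
      · rw [← h, sjmCoef_last k _ (hev i), zero_smul]
      · rw [az i (j-1) (by omega), smul_zero]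
  have ah : ∀ i j, h (a i j) = ((n i : k) - 2 * (j : k)) • a i j := by
    intro i j
    by_cases hj : j < n i + 1
    · rw [show a i j = b ⟨i, ⟨j, hj⟩⟩ from (ab i ⟨j, hj⟩).symm]
      rw [show h (b ⟨i, ⟨j, hj⟩⟩) = _ from b.constr_basis k _ _, ab]
    · rw [az i j (by omega), map_zero, smul_zero]
  have s0 : ∀ i, sjmCoef k (n i) 0 = 0 := fun i => by simp [sjmCoef]
  have hom : ∀ p, b p ∈ V0 ∨ b p ∈ V1 := by
    rintro ⟨i, j⟩
    rw [ab]
    rcases Nat.mod_two_eq_zero_or_one (j + ε i) with h | h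
    · exact Or.inl (a0 _ _ h)
    · exact Or.inr (a1 _ _ h)
  have par0 : ∀ p : (i : Fin m) × Fin (n i + 1), b p ∈ V0 → ((p.2 : ℕ) + ε p.1) % 2 = 0 := by
    rintro ⟨i, j⟩ hp
    by_contra hc
    refine b.ne_zero ⟨i, j⟩ (Submodule.disjoint_def.1 hcompl.disjoint _ hp ?_)
    rw [ab]; exact a1 _ _ (by dsimp only at hc; omega)
  have par1 : ∀ p : (i : Fin m) × Fin (n i + 1), b p ∈ V1 → ((p.2 : ℕ) + ε p.1) % 2 = 1 := by
    rintro ⟨i, j⟩ hp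
    by_contra hc
    refine b.ne_zero ⟨i, j⟩ (Submodule.disjoint_def.1 hcompl.disjoint _ ?_ hp)
    rw [ab]; exact a0 _ _ (by dsimp only at hc; omega)
  have Ypar : ∀ (T : Submodule k V) i j, (1 ≤ j → a i (j - 1) ∈ T) → Y (a i j) ∈ T := by
    intro T i j hT
    rw [aY]
    rcases Nat.eq_zero_or_pos j with rfl | hj
    · rw [s0, zero_smul]; exact T.zero_mem
    · exact T.smul_mem _ (hT hj)
  refine ⟨h, Y, ⟨?_, ?_⟩, ⟨?_, ?_⟩, ?_, ?_, ?_⟩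
  · refine sjm_parity V0 V1 V0 hcompl.disjoint b hom h ?_
    rintro ⟨i, j⟩ hp
    rw [ab] at hp ⊢
    rw [ah]; exact V0.smul_mem _ hp
  · refine sjm_parity V1 V0 V1 hcompl.disjoint.symm b (fun p => (hom p).symm) h ?_
    rintro ⟨i, j⟩ hp
    rw [ab] at hp ⊢
    rw [ah]; exact V1.smul_mem _ hp
  · refine sjm_parity V0 V1 V1 hcompl.disjoint b hom Y ?_
    rintro ⟨i, j⟩ hp
    have hq := par0 _ hp
    dsimp only at hq
    rw [ab]
    exact Ypar _ _ _ fun hj => a1 _ _ (by omega)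
  · refine sjm_parity V1 V0 V0 hcompl.disjoint.symm b (fun p => (hom p).symm) Y ?_
    rintro ⟨i, j⟩ hp
    have hq := par1 _ hp
    dsimp only at hq
    rw [ab]
    exact Ypar _ _ _ fun hj => a0 _ _ (by omega)
  · refine b.ext ?_
    rintro ⟨i, j⟩
    simp only [ab, LinearMap.sub_apply, LinearMap.comp_apply, LinearMap.neg_apply,
      LinearMap.smul_apply, ax, ah, map_smul]
    push_cast
    module
  · refine b.ext ?_
    rintro ⟨i, j⟩
    simp only [ab, LinearMap.sub_apply, LinearMap.comp_apply,
      LinearMap.smul_apply, aY, ah, map_smul]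
    rcases Nat.eq_zero_or_pos (j : ℕ) with hj | hj
    · rw [hj, s0]; simp
    · rw [Nat.cast_sub hj]
      push_cast
      module
  · refine b.ext ?_
    rintro ⟨i, j⟩
    simp only [ab, LinearMap.add_apply, LinearMap.comp_apply, aY, ah, ax, map_smul]
    rw [← sjmCoef_add, add_smul, Nat.add_sub_cancel]
    rcases Nat.eq_zero_or_pos (j : ℕ) with hj | hj
    · rw [hj, s0]; simp
    · rw [Nat.sub_add_cancel hj]
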